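/- Let ν ∈ ℕ, let ω ∈ ℝ^ν be non-resonant, and let b = ν − 1. For every ε > 0 there exists a constant K = K(ω, ε) > 0 such that for every T ∈ (0,1], all C₁, C₂ with 1 ≤ C₁ ≤ C₂, every a : ℤ^ν → ℂ supported in {n : |n| ≤ C₁}, and every b' : ℤ^ν → ℂ supported in {n : |n| ≤ C₂}, setting u₁(t,x) = ∑_n a_n e^{i(⟨n⟩_ω x − t⟨n⟩_ω²)} and u₂(t,x) = ∑_n b'_n e^{i(⟨n⟩_ω x − t⟨n⟩_ω²)}, one has limsup_{L→∞} (1/(2L)) ∫_0^T ∫_{−L}^{L} |u₁(t,x) u₂(t,x)|² dx dt ≤ K² · T^{1/2} · C₁^{b + 2ε} · ( ∑_n |a_n|² ) ( ∑_n |b'_n|² ). (Bilinear L² Strichartz estimate for free Schrödinger evolutions of quasi-periodic data, the free-solution form of Proposition 5.5.) -/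

import Mathlib

open MeasureTheory Filter

/-- The frequency `⟨n⟩_ω = n · ω` of a lattice point `n ∈ ℤ^ν`. -/
noncomputable def freqQP {ν : ℕ} (ω : Fin ν → ℝ) (n : Fin ν → ℤ) : ℝ :=
  ∑ i, (n i : ℝ) * ω i

/-- The height `|n|` (Euclidean norm) of a lattice point `n ∈ ℤ^ν`. -/
noncomputable def heightQP {ν : ℕ} (n : Fin ν → ℤ) : ℝ :=
  Real.sqrt (∑ i, ((n i : ℝ)) ^ 2)


/-- The time integral. -/
noncomputable def timeJ (T d : ℝ) : ℂ := ∫ t in Set.Icc (0:ℝ) T, Complex.exp (Complex.I * ((t * d : ℝ) : ℂ))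

theorem int_exp_sub (d a b : ℝ) (hab : a ≤ b) (hd : d ≠ 0) :
    ∫ t in Set.Icc a b, Complex.exp (Complex.I * ((t * d : ℝ) : ℂ))
      = (Complex.exp (Complex.I * d * b) - Complex.exp (Complex.I * d * a)) / (Complex.I * d) := by
  rw [integral_Icc_eq_integral_Ioc, ← intervalIntegral.integral_of_le hab]
  have hc : Complex.I * (d:ℂ) ≠ 0 := mul_ne_zero Complex.I_ne_zero (by exact_mod_cast hd)
  rw [← integral_exp_mul_complex hc]
  congr 1
  ext t
  push_cast
  congr 1
  ring

theorem norm_int_exp (d a b : ℝ) (hab : a ≤ b) :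
    ‖∫ t in Set.Icc a b, Complex.exp (Complex.I * ((t * d : ℝ) : ℂ))‖ * |d| ≤ 2 := by
  by_cases hd : d = 0
  · simp [hd]
  rw [int_exp_sub d a b hab hd, norm_div]
  have h0 : ‖Complex.I * (d:ℂ)‖ = |d| := by simp
  rw [h0, div_mul_cancel₀ _ (abs_ne_zero.mpr hd)]
  refine (norm_sub_le _ _).trans ?_
  have h1 : ∀ y : ℝ, ‖Complex.exp (Complex.I * d * y)‖ = 1 := by
    intro y
    have : Complex.I * (d:ℂ) * y = ((d*y:ℝ):ℂ) * Complex.I := by push_cast; ring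
    rw [this, Complex.norm_exp_ofReal_mul_I]
  rw [h1, h1]; norm_num

theorem norm_expI (y : ℝ) : ‖Complex.exp (Complex.I * (y:ℂ))‖ = 1 := by
  rw [mul_comm, Complex.norm_exp_ofReal_mul_I]

theorem timeJ_le (T d : ℝ) (hT : 0 ≤ T) : ‖timeJ T d‖ ≤ T := by
  unfold timeJ
  have := norm_setIntegral_le_of_norm_le_const (μ := volume) (s := Set.Icc (0:ℝ) T) (C := 1)
    (f := fun t => Complex.exp (Complex.I * ((t * d : ℝ) : ℂ))) (by simp)
    (fun t _ => (norm_expI _).le)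
  simpa [hT] using this

theorem timeJ_bound (T d z : ℝ) (hT : 0 ≤ T) (hz : 2 * z ^ 2 ≤ |d|) :
    ‖timeJ T d‖ ≤ 2 * (T / (1 + T * z ^ 2)) := by
  have h1 := timeJ_le T d hT
  have h2 : ‖timeJ T d‖ * |d| ≤ 2 := norm_int_exp d 0 T hT
  have h0 := norm_nonneg (timeJ T d)
  have h3 : ‖timeJ T d‖ * (2 * z ^ 2) ≤ 2 := (mul_le_mul_of_nonneg_left hz h0).trans h2
  rw [← mul_div_assoc, le_div_iff₀ (by positivity)]
  nlinarith

theorem mean_tendsto (d : ℝ) :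
    Tendsto (fun L : ℝ => ((1 / (2 * L) : ℝ) : ℂ) *
      ∫ x in Set.Icc (-L) L, Complex.exp (Complex.I * ((x * d : ℝ) : ℂ))) atTop
      (nhds (if d = 0 then 1 else 0)) := by
  split_ifs with hd
  · refine tendsto_const_nhds.congr' ?_
    filter_upwards [eventually_gt_atTop 0] with L hL
    have hL' : (L:ℂ) ≠ 0 := by exact_mod_cast hL.ne'
    have : max (L + L) 0 = 2 * L := by rw [max_eq_left (by linarith)]; ring
    simp [hd, this]
    field_simp
  · rw [tendsto_zero_iff_norm_tendsto_zero]
    have hlim : Tendsto (fun L : ℝ => L⁻¹ * |d|⁻¹) atTop (nhds 0) := by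
      simpa using tendsto_inv_atTop_zero.mul_const (|d|⁻¹)
    refine squeeze_zero' (Eventually.of_forall fun _ => norm_nonneg _) ?_ hlim
    filter_upwards [eventually_gt_atTop 0] with L hL
    have h := norm_int_exp d (-L) L (by linarith)
    have hd' : 0 < |d| := abs_pos.mpr hd
    rw [norm_mul, Complex.norm_real, Real.norm_of_nonneg (by positivity)]
    rw [← le_div_iff₀ hd'] at h
    calc _ ≤ 1 / (2 * L) * (2 / |d|) := by gcongr
      _ = _ := by field_simp

open ComplexConjugate in
theorem expand_sq {ι : Type*} (P : Finset ι) (c : ι → ℂ) (l m : ι → ℝ) (t x : ℝ) :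
    ((‖∑ p ∈ P, c p * Complex.exp (Complex.I * ((l p * x - t * m p : ℝ) : ℂ))‖ ^ 2 : ℝ) : ℂ)
    = ∑ p ∈ P, ∑ q ∈ P, c p * conj (c q) * (Complex.exp (Complex.I * ((t * (m q - m p) : ℝ) : ℂ))
        * Complex.exp (Complex.I * ((x * (l p - l q) : ℝ) : ℂ))) := by
  rw [← Complex.normSq_eq_norm_sq, ← Complex.mul_conj, map_sum, Finset.sum_mul_sum]
  refine Finset.sum_congr rfl fun p _ => Finset.sum_congr rfl fun q _ => ?_
  rw [map_mul, ← Complex.exp_conj, map_mul, Complex.conj_I, Complex.conj_ofReal,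
    mul_mul_mul_comm, ← Complex.exp_add, ← Complex.exp_add]
  congr 2
  push_cast
  ring

open ComplexConjugate in
theorem double_int {ι : Type*} (P : Finset ι) (c : ι → ℂ) (l m : ι → ℝ) (T L : ℝ) :
    ((∫ t in Set.Icc (0:ℝ) T, ∫ x in Set.Icc (-L) L,
      ‖∑ p ∈ P, c p * Complex.exp (Complex.I * ((l p * x - t * m p : ℝ) : ℂ))‖ ^ 2 : ℝ) : ℂ)
    = ∑ p ∈ P, ∑ q ∈ P, c p * conj (c q) * timeJ T (m q - m p) *
        ∫ x in Set.Icc (-L) L, Complex.exp (Complex.I * ((x * (l p - l q) : ℝ) : ℂ)) := by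
  have hIntg : ∀ (a b : ℝ) (d : ℝ) , Integrable (fun t : ℝ => Complex.exp (Complex.I * ((t * d : ℝ) : ℂ)))
      (volume.restrict (Set.Icc a b)) := by
    intro a b d
    exact (Continuous.integrableOn_Icc (by fun_prop))
  rw [← integral_complex_ofReal]
  simp_rw [← integral_complex_ofReal, expand_sq]
  have inner : ∀ t : ℝ, (∫ x in Set.Icc (-L) L, ∑ p ∈ P, ∑ q ∈ P, c p * conj (c q) *
      (Complex.exp (Complex.I * ((t * (m q - m p) : ℝ) : ℂ))
        * Complex.exp (Complex.I * ((x * (l p - l q) : ℝ) : ℂ)))) =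
      ∑ p ∈ P, ∑ q ∈ P, c p * conj (c q) *
      (Complex.exp (Complex.I * ((t * (m q - m p) : ℝ) : ℂ))
        * ∫ x in Set.Icc (-L) L, Complex.exp (Complex.I * ((x * (l p - l q) : ℝ) : ℂ))) := by
    intro t
    rw [integral_finsetSum]
    · refine Finset.sum_congr rfl fun p _ => ?_
      rw [integral_finsetSum]
      · refine Finset.sum_congr rfl fun q _ => ?_
        rw [integral_const_mul, integral_const_mul]
      · intro q _
        exact ((hIntg _ _ _).const_mul _).const_mul _
    · intro p _
      refine integrable_finsetSum _ fun q _ => ?_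
      exact ((hIntg _ _ _).const_mul _).const_mul _
  simp_rw [inner]
  rw [integral_finsetSum]
  · refine Finset.sum_congr rfl fun p _ => ?_
    rw [integral_finsetSum]
    · refine Finset.sum_congr rfl fun q _ => ?_
      rw [integral_const_mul, integral_mul_const, timeJ, mul_assoc (c p * _)]
    · intro q _
      exact ((hIntg _ _ _).mul_const _).const_mul _
  · intro p _
    refine integrable_finsetSum _ fun q _ => ?_
    exact ((hIntg _ _ _).mul_const _).const_mul _

open ComplexConjugate in
theorem mean_limit {ι : Type*} (P : Finset ι) (c : ι → ℂ) (l m : ι → ℝ) (T : ℝ) :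
    Tendsto (fun L : ℝ => (1 / (2 * L)) * ∫ t in Set.Icc (0:ℝ) T, ∫ x in Set.Icc (-L) L,
      ‖∑ p ∈ P, c p * Complex.exp (Complex.I * ((l p * x - t * m p : ℝ) : ℂ))‖ ^ 2) atTop
    (nhds (∑ p ∈ P, ∑ q ∈ P, c p * conj (c q) * timeJ T (m q - m p) *
      (if l p - l q = 0 then 1 else 0)).re) := by
  have key : Tendsto (fun L : ℝ => ∑ p ∈ P, ∑ q ∈ P, c p * conj (c q) * timeJ T (m q - m p) *
      (((1 / (2 * L) : ℝ) : ℂ) *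
        ∫ x in Set.Icc (-L) L, Complex.exp (Complex.I * ((x * (l p - l q) : ℝ) : ℂ)))) atTop
    (nhds (∑ p ∈ P, ∑ q ∈ P, c p * conj (c q) * timeJ T (m q - m p) *
      (if l p - l q = 0 then 1 else 0))) :=
    tendsto_finsetSum _ fun p _ => tendsto_finsetSum _ fun q _ =>
      (mean_tendsto (l p - l q)).const_mul _
  refine ((Complex.continuous_re.tendsto _).comp key).congr fun L => ?_
  rw [Function.comp, ← Complex.ofReal_re (1 / (2 * L) * _), Complex.ofReal_mul, double_int,
    Finset.mul_sum]
  congr 1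
  refine Finset.sum_congr rfl fun p _ => ?_
  rw [Finset.mul_sum]
  refine Finset.sum_congr rfl fun q _ => ?_
  ring

theorem schur_bound {ι : Type*} (P : Finset ι) (w : ι → ℝ) (M : ι → ι → ℝ)
    (hM : ∀ p q, 0 ≤ M p q) (hsym : ∀ p q, M p q = M q p) (B : ℝ)
    (hB : ∀ p ∈ P, ∑ q ∈ P, M p q ≤ B) :
    ∑ p ∈ P, ∑ q ∈ P, w p * w q * M p q ≤ B * ∑ p ∈ P, w p ^ 2 := by
  have h1 : ∑ p ∈ P, ∑ q ∈ P, w p * w q * M p q ≤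
      ∑ p ∈ P, ∑ q ∈ P, (w p ^ 2 * M p q / 2 + w q ^ 2 * M q p / 2) := by
    refine Finset.sum_le_sum fun p _ => Finset.sum_le_sum fun q _ => ?_
    rw [hsym q p]
    nlinarith [mul_nonneg (sq_nonneg (w p - w q)) (hM p q)]
  refine h1.trans ?_
  simp_rw [Finset.sum_add_distrib]
  rw [Finset.sum_comm (f := fun p q => w q ^ 2 * M q p / 2), ← Finset.sum_add_distrib,
    Finset.mul_sum]
  refine Finset.sum_le_sum fun p hp => ?_
  have : ∑ q ∈ P, w p ^ 2 * M p q / 2 = w p ^ 2 * (∑ q ∈ P, M p q) / 2 := by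
    rw [Finset.mul_sum, Finset.sum_div]
  rw [this]
  nlinarith [mul_le_mul_of_nonneg_left (hB p hp) (sq_nonneg (w p))]

/-- one-sided telescoping -/
theorem tele (r : ℝ) (hr : 0 < r) (N : ℕ) :
    ∑ j ∈ Finset.range N, 1 / (1 + (r * ((j:ℝ) + 1)) ^ 2) ≤ 2 / r * (1 - 1 / (1 + r * N)) := by
  induction N with
  | zero => simp
  | succ N ih =>
    rw [Finset.sum_range_succ]
    have h1 : 0 < 1 + r * N := by positivity
    have h2 : 0 < 1 + r * (N + 1) := by positivity
    have : 1 / (1 + (r * ((N:ℝ) + 1)) ^ 2) ≤ 2 / r * (1 / (1 + r * N) - 1 / (1 + r * (N+1))) := by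
      have e : 2 / r * (1 / (1 + r * N) - 1 / (1 + r * (N+1))) = 2 / ((1 + r * N) * (1 + r * (N+1))) := by
        field_simp; ring
      rw [e, div_le_div_iff₀ (by positivity) (by positivity)]
      nlinarith [sq_nonneg (1 - r * ((N:ℝ)+1)), mul_pos hr h2]
    push_cast
    linarith

theorem tele2 (r : ℝ) (hr : 0 < r) (F : Finset ℤ) :
    ∑ j ∈ F, 1 / (1 + (r * (j:ℝ)) ^ 2) ≤ 1 + 4 / r := by
  obtain ⟨N, hN⟩ : ∃ N : ℕ, ∀ j ∈ F, j.natAbs ≤ N :=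
    ⟨F.sup Int.natAbs, fun j hj => Finset.le_sup (f := Int.natAbs) hj⟩
  set g : ℤ → ℝ := fun j => 1 / (1 + (r * (j:ℝ)) ^ 2) with hg
  have hsub : F ⊆ {0} ∪ ((Finset.range N).image (fun j : ℕ => (j:ℤ) + 1) ∪
      (Finset.range N).image (fun j : ℕ => -((j:ℤ) + 1))) := by
    intro j hj
    have := hN j hj
    simp only [Finset.mem_union, Finset.mem_singleton, Finset.mem_image, Finset.mem_range]
    rcases lt_trichotomy j 0 with h | h | h
    · right; right; exact ⟨j.natAbs - 1, by omega, by omega⟩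
    · left; exact h
    · right; left; exact ⟨j.natAbs - 1, by omega, by omega⟩
  have g0 : ∀ j, 0 ≤ g j := fun j => by simp only [hg]; positivity
  have hun : ∀ A B : Finset ℤ, ∑ j ∈ A ∪ B, g j ≤ ∑ j ∈ A, g j + ∑ j ∈ B, g j := fun A B => by
    have := Finset.sum_union_inter (s₁ := A) (s₂ := B) (f := g)
    have := Finset.sum_nonneg (s := A ∩ B) (f := g) (fun j _ => g0 j)
    linarith
  have ht : ∑ j ∈ Finset.range N, 1 / (1 + (r * ((j:ℝ) + 1)) ^ 2) ≤ 2 / r := by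
    refine (tele r hr N).trans ?_
    have : 0 ≤ 2 / r * (1 / (1 + r * N)) := by positivity
    linarith
  have e1 : ∑ j ∈ (Finset.range N).image (fun j : ℕ => (j:ℤ) + 1), g j ≤ 2 / r := by
    rw [Finset.sum_image (by intro a _ b _ h; simp only at h; omega)]
    simpa [hg] using ht
  have e2 : ∑ j ∈ (Finset.range N).image (fun j : ℕ => -((j:ℤ) + 1)), g j ≤ 2 / r := by
    rw [Finset.sum_image (by intro a _ b _ h; simp only at h; omega)]
    refine le_trans (le_of_eq ?_) ht
    refine Finset.sum_congr rfl fun j _ => ?_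
    simp only [hg]
    push_cast
    ring
  have h1 := Finset.sum_le_sum_of_subset_of_nonneg hsub (fun j _ _ => g0 j)
  have h2 := hun {0} ((Finset.range N).image (fun j : ℕ => (j:ℤ) + 1) ∪
      (Finset.range N).image (fun j : ℕ => -((j:ℤ) + 1)))
  have h3 := hun ((Finset.range N).image (fun j : ℕ => (j:ℤ) + 1))
      ((Finset.range N).image (fun j : ℕ => -((j:ℤ) + 1)))
  have h4 : ∑ j ∈ ({0} : Finset ℤ), g j = 1 := by simp [hg]
  have : 4 / r = 2 / r + 2 / r := by ring
  linarith

theorem sum1d (w T : ℝ) (hw : 0 < w) (hT : 0 < T) (hT1 : T ≤ 1) (s : ℝ) (F : Finset ℤ) :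
    ∑ j ∈ F, T / (1 + T * ((j:ℝ) * w + s) ^ 2) ≤ (1 + 8 / w) * √T := by
  set m : ℤ := round (-s / w) with hm
  have hr : |(-s / w) - m| ≤ 1 / 2 := abs_sub_round _
  have hsT : 0 < √T := Real.sqrt_pos.mpr hT
  have hTT : √T ^ 2 = T := Real.sq_sqrt hT.le
  have hle : ∀ j : ℤ, T / (1 + T * ((j:ℝ) * w + s) ^ 2) ≤
      T * (1 / (1 + ((√T * w / 2) * ((j - m : ℤ):ℝ)) ^ 2)) := by
    intro j
    rw [mul_one_div]
    have : ((√T * w / 2) * ((j - m : ℤ):ℝ)) ^ 2 ≤ T * ((j:ℝ) * w + s) ^ 2 := by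
      rw [mul_pow, div_pow, mul_pow, hTT]
      have h1 : (((j - m : ℤ):ℝ)) ^ 2 / 4 ≤ (j - (-s / w)) ^ 2 := by
        by_cases hj : j = m
        · simp [hj]; positivity
        · have h2 : (1:ℝ) ≤ |((j - m : ℤ):ℝ)| := by
            have : 1 ≤ |j - m| := Int.one_le_abs (sub_ne_zero.mpr hj)
            exact_mod_cast this
          have h3 : |((j - m : ℤ):ℝ)| ≤ |(j:ℝ) - (-s/w)| + |(-s / w) - m| := by
            push_cast
            exact abs_sub_le _ _ _
          have h4 : |((j - m : ℤ):ℝ)| / 2 ≤ |(j:ℝ) - (-s/w)| := by linarith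
          have h5 := pow_le_pow_left₀ (by positivity) h4 2
          rw [div_pow, sq_abs, sq_abs] at h5
          linarith
      have e : ((j:ℝ) * w + s) ^ 2 = w ^ 2 * (j - (-s / w)) ^ 2 := by
        field_simp; ring
      rw [e]
      calc _ = T * (w ^ 2 * ((((j - m : ℤ):ℝ)) ^ 2 / 4)) := by ring
        _ ≤ _ := by gcongr
    gcongr
  refine (Finset.sum_le_sum fun j _ => hle j).trans ?_
  rw [← Finset.mul_sum]
  have h := tele2 (√T * w / 2) (by positivity) (F.image (fun j => j - m))
  rw [Finset.sum_image (by intro a _ b _ h; simp only at h; omega)] at h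
  refine (mul_le_mul_of_nonneg_left h hT.le).trans ?_
  have h1 : T ≤ √T := Real.le_sqrt_of_sq_le (by nlinarith)
  have h2 : T * (4 / (√T * w / 2)) = 8 / w * √T := by
    nth_rewrite 1 [← hTT]
    field_simp; norm_num
  rw [mul_add, h2]
  linarith

/-- box -/
noncomputable def boxQP (ν : ℕ) (N : ℕ) : Finset (Fin ν → ℤ) := Fintype.piFinset fun _ => Finset.Icc (-(N:ℤ)) N

theorem sumBox (k N : ℕ) (ω : Fin (k+1) → ℝ) (hw : 0 < ω 0) (T : ℝ) (hT : 0 < T) (hT1 : T ≤ 1) (s : ℝ) :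
    ∑ n ∈ boxQP (k+1) N, T / (1 + T * (freqQP ω n - s) ^ 2) ≤
      (2 * N + 1 : ℝ) ^ k * ((1 + 8 / ω 0) * √T) := by
  have hmap : ∀ n ∈ boxQP (k+1) N, Fin.tail n ∈ boxQP k N := by
    intro n hn
    simp only [boxQP, Fintype.mem_piFinset] at hn ⊢
    intro i
    exact hn i.succ
  rw [← Finset.sum_fiberwise_of_maps_to hmap]
  have hcard : ((boxQP k N).card : ℝ) = (2 * N + 1 : ℝ) ^ k := by
    have h : ((N:ℤ) + 1 + (N:ℤ)).toNat = 2 * N + 1 := by omega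
    simp [boxQP, h]
  rw [← hcard, ← nsmul_eq_mul]
  refine Finset.sum_le_card_nsmul _ _ _ fun v _ => ?_
  have h := sum1d (ω 0) T hw hT hT1 (∑ i : Fin k, (v i : ℝ) * ω i.succ - s)
    (((boxQP (k+1) N).filter (fun n => Fin.tail n = v)).image (fun n => n 0))
  rw [Finset.sum_image] at h
  · refine le_trans (le_of_eq ?_) h
    refine Finset.sum_congr rfl fun n hn => ?_
    have hn' := (Finset.mem_filter.mp hn).2
    have : freqQP ω n - s = (n 0 : ℝ) * ω 0 + (∑ i : Fin k, (v i : ℝ) * ω i.succ - s) := by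
      rw [freqQP, Fin.sum_univ_succ, ← hn']
      simp only [Fin.tail]
      ring
    rw [this]
  · intro n hn n' hn' h0
    have e1 := (Finset.mem_filter.mp hn).2
    have e2 := (Finset.mem_filter.mp hn').2
    simp only at h0
    rw [← Fin.cons_self_tail n, ← Fin.cons_self_tail n', e1, e2, h0]

theorem timeJ_symm (T d : ℝ) : ‖timeJ T (-d)‖ = ‖timeJ T d‖ := by
  have : timeJ T (-d) = (starRingEnd ℂ) (timeJ T d) := by
    unfold timeJ
    rw [← integral_conj]
    congr 1
    ext t
    rw [← Complex.exp_conj, map_mul, Complex.conj_I, Complex.conj_ofReal]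
    congr 1
    push_cast
    ring
  rw [this, RCLike.norm_conj]

theorem freqQP_add {ν : ℕ} (ω : Fin ν → ℝ) (n m : Fin ν → ℤ) :
    freqQP ω (n + m) = freqQP ω n + freqQP ω m := by
  simp [freqQP, add_mul, Finset.sum_add_distrib]

theorem freqQP_sub {ν : ℕ} (ω : Fin ν → ℝ) (n m : Fin ν → ℤ) :
    freqQP ω (n - m) = freqQP ω n - freqQP ω m := by
  simp [freqQP, sub_mul, Finset.sum_sub_distrib]

theorem mem_boxQP {ν : ℕ} (n : Fin ν → ℤ) (C : ℝ) (h : heightQP n ≤ C) :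
    n ∈ boxQP ν ⌊C⌋₊ := by
  simp only [boxQP, Fintype.mem_piFinset, Finset.mem_Icc]
  intro i
  have h1 : |(n i : ℝ)| ≤ C := by
    refine le_trans ?_ h
    rw [heightQP]
    refine Real.abs_le_sqrt ?_
    exact Finset.single_le_sum (f := fun i => (n i : ℝ) ^ 2) (fun i _ => sq_nonneg _)
      (Finset.mem_univ i)
  have h2 : (n i).natAbs ≤ ⌊C⌋₊ := by
    refine Nat.le_floor ?_
    rw [Nat.cast_natAbs]
    exact_mod_cast h1
  omega

theorem kernel_bound (T s m y m' : ℝ) (hT : 0 ≤ T) (h : s + m = y + m') :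
    ‖timeJ T ((y ^ 2 + m' ^ 2) - (s ^ 2 + m ^ 2))‖ ≤
      2 * (T / (1 + T * (y - s) ^ 2)) + 2 * (T / (1 + T * (y - m) ^ 2)) := by
  have hd : |(y ^ 2 + m' ^ 2) - (s ^ 2 + m ^ 2)| = 2 * (|y - s| * |y - m|) := by
    have : m' = s + m - y := by linarith
    have e : (y ^ 2 + m' ^ 2) - (s ^ 2 + m ^ 2) = 2 * ((y - s) * (y - m)) := by rw [this]; ring
    rw [e, abs_mul, abs_mul]; norm_num
  have p1 : 0 ≤ 2 * (T / (1 + T * (y - s) ^ 2)) := by positivity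
  have p2 : 0 ≤ 2 * (T / (1 + T * (y - m) ^ 2)) := by positivity
  rcases le_total |y - s| |y - m| with h1 | h1
  · have := timeJ_bound T _ (y - s) hT (by
      rw [hd, ← sq_abs]; nlinarith [abs_nonneg (y - s)])
    linarith
  · have := timeJ_bound T _ (y - m) hT (by
      rw [hd, ← sq_abs]; nlinarith [abs_nonneg (y - m)])
    linarith

theorem main_finite (k N : ℕ) (ω : Fin (k+1) → ℝ) (hw : 0 < ω 0)
    (hnr : ∀ n : Fin (k+1) → ℤ, freqQP ω n = 0 → n = 0)
    (T : ℝ) (hT : 0 < T) (hT1 : T ≤ 1) (S : Finset (Fin (k+1) → ℤ))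
    (a b : (Fin (k+1) → ℤ) → ℂ) :
    limsup (fun L : ℝ =>
          (1 / (2 * L)) * ∫ t in Set.Icc (0 : ℝ) T, ∫ x in Set.Icc (-L) L,
            ‖(∑ n ∈ boxQP (k+1) N, a n *
                Complex.exp (Complex.I *
                  ((freqQP ω n * x - t * freqQP ω n ^ 2 : ℝ) : ℂ))) *
              (∑ n ∈ S, b n *
                Complex.exp (Complex.I *
                  ((freqQP ω n * x - t * freqQP ω n ^ 2 : ℝ) : ℂ)))‖ ^ 2) atTop
      ≤ (4 * ((2 * N + 1 : ℝ) ^ k * ((1 + 8 / ω 0) * √T))) *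
        ((∑ n ∈ boxQP (k+1) N, ‖a n‖ ^ 2) * (∑ n ∈ S, ‖b n‖ ^ 2)) := by
  classical
  set P := boxQP (k+1) N ×ˢ S with hP
  set c : (Fin (k+1) → ℤ) × (Fin (k+1) → ℤ) → ℂ := fun p => a p.1 * b p.2 with hc
  set l : (Fin (k+1) → ℤ) × (Fin (k+1) → ℤ) → ℝ := fun p => freqQP ω p.1 + freqQP ω p.2 with hl
  set m : (Fin (k+1) → ℤ) × (Fin (k+1) → ℤ) → ℝ :=
    fun p => freqQP ω p.1 ^ 2 + freqQP ω p.2 ^ 2 with hm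
  have hprod : ∀ t x : ℝ, (∑ n ∈ boxQP (k+1) N, a n * Complex.exp (Complex.I *
                  ((freqQP ω n * x - t * freqQP ω n ^ 2 : ℝ) : ℂ))) *
              (∑ n ∈ S, b n * Complex.exp (Complex.I *
                  ((freqQP ω n * x - t * freqQP ω n ^ 2 : ℝ) : ℂ))) =
      ∑ p ∈ P, c p * Complex.exp (Complex.I * ((l p * x - t * m p : ℝ) : ℂ)) := by
    intro t x
    rw [Finset.sum_mul_sum, hP, Finset.sum_product]
    refine Finset.sum_congr rfl fun n _ => Finset.sum_congr rfl fun q _ => ?_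
    rw [mul_mul_mul_comm, ← Complex.exp_add]
    simp only [hc, hl, hm]
    congr 2
    push_cast
    ring
  simp_rw [hprod]
  rw [(mean_limit P c l m T).limsup_eq]
  set M : (Fin (k+1) → ℤ) × (Fin (k+1) → ℤ) → (Fin (k+1) → ℤ) × (Fin (k+1) → ℤ) → ℝ :=
    fun p q => if l p - l q = 0 then ‖timeJ T (m q - m p)‖ else 0 with hM
  have h1 : (∑ p ∈ P, ∑ q ∈ P, c p * (starRingEnd ℂ) (c q) * timeJ T (m q - m p) *
      (if l p - l q = 0 then 1 else 0)).re ≤ ∑ p ∈ P, ∑ q ∈ P, ‖c p‖ * ‖c q‖ * M p q := by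
    refine (Complex.re_le_norm _).trans ?_
    refine (norm_sum_le _ _).trans (Finset.sum_le_sum fun p _ => ?_)
    refine (norm_sum_le _ _).trans (Finset.sum_le_sum fun q _ => ?_)
    rw [norm_mul, norm_mul, norm_mul, RCLike.norm_conj, mul_assoc]
    simp only [hM]
    split_ifs <;> simp
  refine h1.trans ?_
  have hsum : ∑ p ∈ P, ‖c p‖ ^ 2 =
      (∑ n ∈ boxQP (k+1) N, ‖a n‖ ^ 2) * (∑ n ∈ S, ‖b n‖ ^ 2) := by
    rw [Finset.sum_mul_sum, hP, Finset.sum_product]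
    simp [hc, mul_pow]
  rw [← hsum]
  refine schur_bound P (fun p => ‖c p‖) M ?_ ?_ _ ?_
  · intro p q
    simp only [hM]
    split_ifs <;> positivity
  · intro p q
    simp only [hM]
    rw [← timeJ_symm T (m q - m p), neg_sub, ← neg_sub (l q) (l p)]
    simp only [neg_eq_zero]
  · rintro ⟨n, n2⟩ _
    set G : (Fin (k+1) → ℤ) → ℝ := fun y => 2 * (T / (1 + T * (freqQP ω y - freqQP ω n) ^ 2)) +
      2 * (T / (1 + T * (freqQP ω y - freqQP ω n2) ^ 2)) with hG
    have G0 : ∀ y, 0 ≤ G y := fun y => by simp only [hG]; positivity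
    have hMG : ∀ q, M (n, n2) q ≤ if n + n2 - q.1 = q.2 then G q.1 else 0 := by
      rintro ⟨q1, q2⟩
      simp only [hM]
      by_cases h : l (n, n2) - l (q1, q2) = 0
      · have h' : n + n2 - q1 = q2 := by
          have := hnr (n + n2 - q1 - q2) (by
            rw [freqQP_sub, freqQP_sub, freqQP_add]
            simp only [hl] at h
            linarith)
          exact sub_eq_zero.mp this
        rw [if_pos h, if_pos h']
        exact kernel_bound T _ _ _ _ hT.le (by simp only [hl] at h; linarith)
      · rw [if_neg h]
        split_ifs
        · exact G0 _
        · exact le_rfl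
    refine (Finset.sum_le_sum fun q _ => hMG q).trans ?_
    rw [hP, Finset.sum_product]
    simp only [Finset.sum_ite_eq]
    have : ∑ y ∈ boxQP (k+1) N, (if n + n2 - y ∈ S then G y else 0) ≤ ∑ y ∈ boxQP (k+1) N, G y := by
      refine Finset.sum_le_sum fun y _ => ?_
      split_ifs
      · exact le_rfl
      · exact G0 y
    refine this.trans ?_
    simp only [hG]
    rw [Finset.sum_add_distrib, ← Finset.mul_sum, ← Finset.mul_sum]
    have e1 := sumBox k N ω hw T hT hT1 (freqQP ω n)
    have e2 := sumBox k N ω hw T hT hT1 (freqQP ω n2)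
    linarith

/-- Bilinear `L²` Strichartz estimate for free Schrödinger evolutions of quasi-periodic
data (free-solution form of Proposition 5.5): the constant involves only the smaller
height-truncation parameter `C₁`. -/
theorem bilinear_L2_strichartz_schrodinger
    (ν : ℕ) (hν : 1 ≤ ν) (ω : Fin ν → ℝ)
    (hpos : ∀ i, 0 < ω i)
    (hnr : ∀ n : Fin ν → ℤ, freqQP ω n = 0 → n = 0)
    (ε : ℝ) (hε : 0 < ε) :
    ∃ K : ℝ, 0 < K ∧ ∀ T : ℝ, T ∈ Set.Ioc (0 : ℝ) 1 →
      ∀ C₁ C₂ : ℝ, 1 ≤ C₁ → C₁ ≤ C₂ →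
      ∀ a : (Fin ν → ℤ) → ℂ, (∀ n, a n ≠ 0 → heightQP n ≤ C₁) →
      ∀ b' : (Fin ν → ℤ) → ℂ, (∀ n, b' n ≠ 0 → heightQP n ≤ C₂) →
      limsup (fun L : ℝ =>
          (1 / (2 * L)) * ∫ t in Set.Icc (0 : ℝ) T, ∫ x in Set.Icc (-L) L,
            ‖(∑' n : Fin ν → ℤ, a n *
                Complex.exp (Complex.I *
                  ((freqQP ω n * x - t * freqQP ω n ^ 2 : ℝ) : ℂ))) *
              (∑' n : Fin ν → ℤ, b' n *
                Complex.exp (Complex.I *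
                  ((freqQP ω n * x - t * freqQP ω n ^ 2 : ℝ) : ℂ)))‖ ^ 2) atTop
        ≤ K ^ 2 * T ^ ((1 : ℝ) / 2) * C₁ ^ (((ν : ℝ) - 1) + 2 * ε) *
            (∑' n : Fin ν → ℤ, ‖a n‖ ^ 2) * (∑' n : Fin ν → ℤ, ‖b' n‖ ^ 2) := by
  obtain ⟨k, rfl⟩ : ∃ k, ν = k + 1 := ⟨ν - 1, by omega⟩
  have hw := hpos 0
  have hA : 0 < 4 * (3:ℝ) ^ k * (1 + 8 / ω 0) := by positivity
  refine ⟨√(4 * (3:ℝ) ^ k * (1 + 8 / ω 0)), Real.sqrt_pos.mpr hA, ?_⟩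
  rintro T ⟨hT, hT1⟩ C₁ C₂ hC1 hC12 a ha b' hb
  have ha' : ∀ n ∉ boxQP (k+1) ⌊C₁⌋₊, a n = 0 := fun n hn => by
    by_contra h
    exact hn (mem_boxQP n C₁ (ha n h))
  have hb' : ∀ n ∉ boxQP (k+1) ⌊C₂⌋₊, b' n = 0 := fun n hn => by
    by_contra h
    exact hn (mem_boxQP n C₂ (hb n h))
  rw [tsum_eq_sum (s := boxQP (k+1) ⌊C₁⌋₊) (f := fun n => ‖a n‖ ^ 2)
      (fun n hn => by simp [ha' n hn]),
    tsum_eq_sum (s := boxQP (k+1) ⌊C₂⌋₊) (f := fun n => ‖b' n‖ ^ 2)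
      (fun n hn => by simp [hb' n hn])]
  have e1 : ∀ t x : ℝ, (∑' n : Fin (k+1) → ℤ, a n * Complex.exp (Complex.I *
                  ((freqQP ω n * x - t * freqQP ω n ^ 2 : ℝ) : ℂ))) =
      ∑ n ∈ boxQP (k+1) ⌊C₁⌋₊, a n * Complex.exp (Complex.I *
                  ((freqQP ω n * x - t * freqQP ω n ^ 2 : ℝ) : ℂ)) := fun t x =>
    tsum_eq_sum (fun n hn => by rw [ha' n hn, zero_mul])
  have e2 : ∀ t x : ℝ, (∑' n : Fin (k+1) → ℤ, b' n * Complex.exp (Complex.I *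
                  ((freqQP ω n * x - t * freqQP ω n ^ 2 : ℝ) : ℂ))) =
      ∑ n ∈ boxQP (k+1) ⌊C₂⌋₊, b' n * Complex.exp (Complex.I *
                  ((freqQP ω n * x - t * freqQP ω n ^ 2 : ℝ) : ℂ)) := fun t x =>
    tsum_eq_sum (fun n hn => by rw [hb' n hn, zero_mul])
  simp_rw [e1, e2]
  refine (main_finite k ⌊C₁⌋₊ ω hw hnr T hT hT1 _ a b').trans ?_
  rw [mul_assoc (_ * _) (∑ n ∈ _, _) (∑ n ∈ _, _)]
  refine mul_le_mul_of_nonneg_right ?_ (by positivity)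
  rw [Real.sq_sqrt hA.le, ← Real.sqrt_eq_rpow]
  have hN : (2 * (⌊C₁⌋₊ : ℝ) + 1) ≤ 3 * C₁ := by
    have := Nat.floor_le (show 0 ≤ C₁ by linarith)
    linarith
  have hp : (2 * (⌊C₁⌋₊ : ℝ) + 1) ^ k ≤ 3 ^ k * C₁ ^ ((((k + 1 : ℕ) : ℝ) - 1) + 2 * ε) := by
    calc _ ≤ (3 * C₁) ^ k := by gcongr
      _ = 3 ^ k * C₁ ^ (k:ℝ) := by rw [mul_pow, Real.rpow_natCast]
      _ ≤ _ := by
        gcongr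
        push_cast; linarith
  calc _ ≤ 4 * ((3 ^ k * C₁ ^ ((((k + 1 : ℕ) : ℝ) - 1) + 2 * ε)) * ((1 + 8 / ω 0) * √T)) := by
        gcongr
    _ = _ := by ring
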